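/- Let G(t) ∈ t·ℚ[[t]] be a formal power series with zero constant term all of whose coefficients are nonnegative, and let R(t), Q(t) ∈ ℂ[t] be polynomials such that Q(t) · exp(G(t)) = R(t) as formal power series in ℂ[[t]]. Then for every real r ≥ 0, if R has a complex root of modulus at most r, then Q has a complex root of modulus at most r; equivalently, any closed disc around the origin in the complex plane containing a root of R(t) necessarily contains a root of Q(t). -/

import Mathlib

/-- The exponential `exp (G) = ∑_{k ≥ 0} G ^ k / k!` of a formal power series `G`
with zero constant term: since `G` has zero constant term, the `n`-th coefficient
only receives contributions from `G ^ k` with `k ≤ n`. -/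
noncomputable def PowerSeries.expOf (G : PowerSeries ℚ) : PowerSeries ℚ :=
  PowerSeries.mk fun n =>
    ∑ k ∈ Finset.range (n + 1), PowerSeries.coeff n (G ^ k) / (Nat.factorial k)

/-- Absolute summability at the point `z`. -/
def PSm (z : ℂ) (A : PowerSeries ℂ) : Prop :=
  Summable fun n => ‖PowerSeries.coeff n A * z ^ n‖

/-- Evaluation at the point `z`. -/
noncomputable def PEv (z : ℂ) (A : PowerSeries ℂ) : ℂ :=
  ∑' n, PowerSeries.coeff n A * z ^ n

lemma coeff_mul_zpow (z : ℂ) (A B : PowerSeries ℂ) (n : ℕ) :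
    PowerSeries.coeff n (A * B) * z ^ n =
      ∑ p ∈ Finset.HasAntidiagonal.antidiagonal n,
        (PowerSeries.coeff p.1 A * z ^ p.1) * (PowerSeries.coeff p.2 B * z ^ p.2) := by
  rw [PowerSeries.coeff_mul, Finset.sum_mul]
  refine Finset.sum_congr rfl fun p hp => ?_
  rw [← Finset.HasAntidiagonal.mem_antidiagonal.1 hp, pow_add]
  ring

lemma PSm.mul {z : ℂ} {A B : PowerSeries ℂ} (hA : PSm z A) (hB : PSm z B) : PSm z (A * B) := by
  unfold PSm
  simp_rw [coeff_mul_zpow]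
  exact summable_norm_sum_mul_antidiagonal_of_summable_norm
    (f := fun n => PowerSeries.coeff n A * z ^ n) (g := fun n => PowerSeries.coeff n B * z ^ n) hA hB

lemma PEv_mul {z : ℂ} {A B : PowerSeries ℂ} (hA : PSm z A) (hB : PSm z B) :
    PEv z (A * B) = PEv z A * PEv z B := by
  unfold PEv
  simp_rw [coeff_mul_zpow]
  exact (tsum_mul_tsum_eq_tsum_sum_antidiagonal_of_summable_norm
    (f := fun n => PowerSeries.coeff n A * z ^ n)
    (g := fun n => PowerSeries.coeff n B * z ^ n) hA hB).symm

lemma poly_zero_of_gt (z : ℂ) (P : Polynomial ℂ) (n : ℕ) (hn : n ∉ Finset.range (P.natDegree + 1)) :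
    PowerSeries.coeff n (P : PowerSeries ℂ) * z ^ n = 0 := by
  rw [Polynomial.coeff_coe, Polynomial.coeff_eq_zero_of_natDegree_lt, zero_mul]
  simp at hn
  omega

lemma PSm_poly (z : ℂ) (P : Polynomial ℂ) : PSm z (P : PowerSeries ℂ) :=
  summable_of_ne_finset_zero (s := Finset.range (P.natDegree + 1))
    fun n hn => by rw [poly_zero_of_gt z P n hn, norm_zero]

lemma PEv_poly (z : ℂ) (P : Polynomial ℂ) : PEv z (P : PowerSeries ℂ) = P.eval z := by
  unfold PEv
  rw [tsum_eq_sum (poly_zero_of_gt z P), Polynomial.eval_eq_sum_range]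
  simp

lemma PSm_one (z : ℂ) : PSm z 1 := by
  simpa using PSm_poly z 1

lemma PEv_one (z : ℂ) : PEv z 1 = 1 := by
  simpa using PEv_poly z 1

lemma PSm.pow {z : ℂ} {A : PowerSeries ℂ} (hA : PSm z A) (k : ℕ) :
    PSm z (A ^ k) ∧ PEv z (A ^ k) = PEv z A ^ k := by
  induction k with
  | zero => simpa using ⟨PSm_one z, PEv_one z⟩
  | succ k ih => exact ⟨by rw [pow_succ]; exact ih.1.mul hA,
      by rw [pow_succ, PEv_mul ih.1 hA, ih.2, pow_succ]⟩

lemma linear_inv {z w : ℂ} (h : ‖z‖ < ‖w‖) :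
    ∃ P, PSm z P ∧ ((Polynomial.X - Polynomial.C w : Polynomial ℂ) : PowerSeries ℂ) * P = 1 := by
  have hw0 : 0 < ‖w‖ := (norm_nonneg z).trans_lt h
  have hw : w ≠ 0 := norm_pos_iff.1 hw0
  refine ⟨PowerSeries.mk fun n => -(w⁻¹) ^ (n + 1), ?_, ?_⟩
  · have : Summable fun n : ℕ => ‖w⁻¹‖ * (‖z‖ / ‖w‖) ^ n :=
      (summable_geometric_of_lt_one (by positivity) ((div_lt_one hw0).2 h)).mul_left _
    refine this.congr fun n => ?_
    simp [pow_succ, div_eq_mul_inv, mul_pow]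
    ring
  · ext n
    rw [Polynomial.coe_sub, Polynomial.coe_X, Polynomial.coe_C, sub_mul, map_sub,
      PowerSeries.coeff_C_mul]
    cases n with
    | zero => simp [hw]
    | succ n =>
      rw [PowerSeries.coeff_succ_X_mul]
      simp [PowerSeries.coeff_one]
      field_simp
      ring

lemma multiset_inv {z : ℂ} (s : Multiset ℂ) (h : ∀ w ∈ s, ‖z‖ < ‖w‖) :
    ∃ P, PSm z P ∧ (((s.map fun w => (Polynomial.X - Polynomial.C w : Polynomial ℂ)).prod :
      Polynomial ℂ) : PowerSeries ℂ) * P = 1 := by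
  induction s using Multiset.induction_on with
  | empty => exact ⟨1, PSm_one z, by simp⟩
  | cons w s ih =>
    obtain ⟨P, hP, hP1⟩ := ih fun x hx => h x (Multiset.mem_cons_of_mem hx)
    obtain ⟨P', hP', hP1'⟩ := linear_inv (h w (Multiset.mem_cons_self w s))
    refine ⟨P' * P, hP'.mul hP, ?_⟩
    rw [Multiset.map_cons, Multiset.prod_cons, Polynomial.coe_mul, mul_mul_mul_comm, hP1, hP1',
      one_mul]

lemma poly_inv {z : ℂ} (Q : Polynomial ℂ) (hQ : Q ≠ 0) (h : ∀ w, Q.IsRoot w → ‖z‖ < ‖w‖) :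
    ∃ P, PSm z P ∧ (Q : PowerSeries ℂ) * P = 1 := by
  obtain ⟨P, hP, hP1⟩ := multiset_inv Q.roots fun w hw => h w (Polynomial.isRoot_of_mem_roots hw)
  have hs := (IsAlgClosed.splits Q).eq_prod_roots
  have hl : Q.leadingCoeff ≠ 0 := Polynomial.leadingCoeff_ne_zero.2 hQ
  refine ⟨((Polynomial.C Q.leadingCoeff⁻¹ : Polynomial ℂ) : PowerSeries ℂ) * P,
    (PSm_poly _ _).mul hP, ?_⟩
  rw [hs, Polynomial.coe_mul, mul_mul_mul_comm, ← hs, hP1, mul_one, ← Polynomial.coe_mul,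
    ← Polynomial.C_mul, mul_inv_cancel₀ hl]
  simp

lemma coeff_pow_nonneg' (G : PowerSeries ℚ) (hpos : ∀ n, 0 ≤ PowerSeries.coeff n G) (k : ℕ) :
    ∀ n, 0 ≤ PowerSeries.coeff n (G ^ k) := by
  induction k with
  | zero => intro n; rw [pow_zero, PowerSeries.coeff_one]; split_ifs <;> norm_num
  | succ k ih =>
    intro n
    rw [pow_succ, PowerSeries.coeff_mul]
    exact Finset.sum_nonneg fun p _ => mul_nonneg (ih _) (hpos _)

lemma coeff_pow_zero' (G : PowerSeries ℚ) (h0 : PowerSeries.constantCoeff G = 0) {k n : ℕ}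
    (h : n < k) : PowerSeries.coeff n (G ^ k) = 0 := by
  have h1 : PowerSeries.X ^ k ∣ G ^ k := pow_dvd_pow_of_dvd (PowerSeries.X_dvd_iff.2 h0) k
  exact PowerSeries.X_pow_dvd_iff.1 h1 n h

lemma coeff_le_expOf (G : PowerSeries ℚ) (h0 : PowerSeries.constantCoeff G = 0)
    (hpos : ∀ n, 0 ≤ PowerSeries.coeff n G) (n : ℕ) :
    PowerSeries.coeff n G ≤ PowerSeries.coeff n (PowerSeries.expOf G) := by
  have hnn : ∀ k ∈ Finset.range (n + 1),
      0 ≤ PowerSeries.coeff n (G ^ k) / (Nat.factorial k : ℚ) := fun k _ =>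
    div_nonneg (coeff_pow_nonneg' G hpos k n) (by positivity)
  rw [PowerSeries.expOf, PowerSeries.coeff_mk]
  cases n with
  | zero =>
    rw [PowerSeries.coeff_zero_eq_constantCoeff_apply, h0]
    exact Finset.sum_nonneg hnn
  | succ n =>
    have := Finset.single_le_sum hnn (a := 1) (by simp)
    simpa using this

lemma PEv_expOf (G : PowerSeries ℚ) (h0 : PowerSeries.constantCoeff G = 0)
    (hpos : ∀ n, 0 ≤ PowerSeries.coeff n G) (z : ℂ)
    (hE : PSm z (PowerSeries.map (algebraMap ℚ ℂ) (PowerSeries.expOf G))) :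
    PEv z (PowerSeries.map (algebraMap ℚ ℂ) (PowerSeries.expOf G)) ≠ 0 := by
  set g := PowerSeries.map (algebraMap ℚ ℂ) G with hg
  have hG : PSm z g := by
    refine Summable.of_nonneg_of_le (fun _ => norm_nonneg _) (fun n => ?_) hE
    rw [norm_mul, norm_mul]
    refine mul_le_mul_of_nonneg_right ?_ (norm_nonneg _)
    have h1 := coeff_le_expOf G h0 hpos n
    have h2 := hpos n
    rw [hg, PowerSeries.coeff_map, PowerSeries.coeff_map, eq_ratCast, eq_ratCast,
      Complex.norm_ratCast, Complex.norm_ratCast, abs_of_nonneg (by exact_mod_cast h2),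
      abs_of_nonneg (by exact_mod_cast h2.trans h1)]
    exact_mod_cast h1
  let a : ℕ → ℕ → ℂ := fun n k => PowerSeries.coeff n (g ^ k) * z ^ n / (Nat.factorial k : ℂ)
  have hgk : ∀ n k, PowerSeries.coeff n (g ^ k) = ((PowerSeries.coeff n (G ^ k) : ℚ) : ℂ) := by
    intro n k
    rw [hg, ← map_pow, PowerSeries.coeff_map, eq_ratCast]
  have ha0 : ∀ n k, k ∉ Finset.range (n + 1) → a n k = 0 := by
    intro n k hk
    simp only [a]
    rw [hgk, coeff_pow_zero' G h0 (by simp at hk; omega)]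
    simp
  have hEn : ∀ n, PowerSeries.coeff n (PowerSeries.map (algebraMap ℚ ℂ) (PowerSeries.expOf G))
      = ∑ k ∈ Finset.range (n + 1), PowerSeries.coeff n (g ^ k) / (Nat.factorial k : ℂ) := by
    intro n
    rw [PowerSeries.coeff_map, PowerSeries.expOf, PowerSeries.coeff_mk, map_sum]
    refine Finset.sum_congr rfl fun k _ => ?_
    rw [hgk]
    simp
  have hrow : ∀ n, ∑' k, a n k =
      PowerSeries.coeff n (PowerSeries.map (algebraMap ℚ ℂ) (PowerSeries.expOf G)) * z ^ n := by
    intro n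
    rw [tsum_eq_sum (ha0 n), hEn, Finset.sum_mul]
    refine Finset.sum_congr rfl fun k _ => ?_
    simp only [a]
    ring
  have hrown : ∀ n, ∑' k, ‖a n k‖ =
      ‖PowerSeries.coeff n (PowerSeries.map (algebraMap ℚ ℂ) (PowerSeries.expOf G)) * z ^ n‖ := by
    intro n
    rw [tsum_eq_sum (s := Finset.range (n + 1)) (fun k hk => by rw [ha0 n k hk, norm_zero]),
      PowerSeries.coeff_map, PowerSeries.expOf, PowerSeries.coeff_mk, norm_mul, eq_ratCast,
      Complex.norm_ratCast, abs_of_nonneg, Rat.cast_sum, Finset.sum_mul]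
    · refine Finset.sum_congr rfl fun k _ => ?_
      simp only [a]
      rw [hgk, norm_div, norm_mul, Complex.norm_ratCast, abs_of_nonneg
        (by exact_mod_cast coeff_pow_nonneg' G hpos k n), Complex.norm_natCast]
      push_cast
      ring
    · have : 0 ≤ ∑ k ∈ Finset.range (n + 1), PowerSeries.coeff n (G ^ k) / (Nat.factorial k : ℚ) :=
        Finset.sum_nonneg fun k _ =>
          div_nonneg (coeff_pow_nonneg' G hpos k n) (by positivity)
      exact_mod_cast this
  have hsum : Summable (Function.uncurry a) := by
    refine Summable.of_norm ?_
    rw [summable_prod_of_nonneg (fun _ => norm_nonneg _)]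
    refine ⟨fun n => ?_, ?_⟩
    · exact summable_of_ne_finset_zero (s := Finset.range (n + 1))
        fun k hk => by simp [Function.uncurry, ha0 n k hk]
    · refine Summable.congr hE fun n => ?_
      exact (hrown n).symm
  have key : PEv z (PowerSeries.map (algebraMap ℚ ℂ) (PowerSeries.expOf G))
      = Complex.exp (PEv z g) := by
    unfold PEv
    simp_rw [← hrow]
    rw [← hsum.tsum_comm, Complex.exp_eq_exp_ℂ, NormedSpace.exp_eq_tsum_div]
    refine tsum_congr fun k => ?_
    have := (hG.pow k).2
    unfold PEv at this
    simp only [a]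
    rw [tsum_div_const, this]
  rw [key]
  exact Complex.exp_ne_zero _

/-- If `G(t) ∈ t·ℚ[[t]]` has zero constant term and nonnegative coefficients and
`R(t), Q(t) ∈ ℂ[t]` satisfy `Q(t)·exp(G(t)) = R(t)` in `ℂ[[t]]`, then every closed
disc about the origin containing a root of `R` contains a root of `Q`. -/
theorem root_in_disc_of_exp_eq_ratio (G : PowerSeries ℚ)
    (h0 : PowerSeries.constantCoeff G = 0)
    (hpos : ∀ n, 0 ≤ PowerSeries.coeff n G)
    (R Q : Polynomial ℂ)
    (h : (Q : PowerSeries ℂ) *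
        PowerSeries.map (algebraMap ℚ ℂ) (PowerSeries.expOf G) = (R : PowerSeries ℂ)) :
    ∀ r : ℝ, 0 ≤ r → (∃ z : ℂ, R.IsRoot z ∧ ‖z‖ ≤ r) → ∃ z : ℂ, Q.IsRoot z ∧ ‖z‖ ≤ r := by
  rintro r hr ⟨z, hz, hzr⟩
  by_contra hcon
  have hno : ∀ w, Q.IsRoot w → r < ‖w‖ := fun w hw => by
    by_contra hlt
    exact hcon ⟨w, hw, not_lt.1 hlt⟩
  have hQ : Q ≠ 0 := by
    rintro rfl
    exact hcon ⟨0, by simp, by simpa using hr⟩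
  obtain ⟨P, hP, hP1⟩ := poly_inv (z := z) Q hQ fun w hw => hzr.trans_lt (hno w hw)
  have hE : PSm z (PowerSeries.map (algebraMap ℚ ℂ) (PowerSeries.expOf G)) := by
    have : PowerSeries.map (algebraMap ℚ ℂ) (PowerSeries.expOf G) = P * (R : PowerSeries ℂ) := by
      rw [← h, ← mul_assoc, mul_comm P, hP1, one_mul]
    rw [this]
    exact hP.mul (PSm_poly z R)
  have h1 := PEv_mul (PSm_poly z Q) hE
  rw [h, PEv_poly, PEv_poly, hz] at h1
  rcases mul_eq_zero.1 h1.symm with h2 | h2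
  · exact hcon ⟨z, h2, hzr⟩
  · exact PEv_expOf G h0 hpos z hE h2
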